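/- arXiv:2307.03523 — 2 statements merged into one kernel-verified Lean document; each statement's English description precedes it below -/
import Mathlib

section
/- Let V be a finite type with a distinguished depot vertex 0 and let σ : V → V be a bijection (the successor map of a truck routing, where σ i = i means vertex i is not visited). Suppose every non-fixed point of σ lies on the cycle of σ through the depot, i.e. for every i with σ i ≠ i there exists a natural number r with σ^[r] 0 = i. Then for every nonempty subset H ⊆ V with 0 ∉ H, the number of vertices i ∈ H such that σ i ∈ H and σ i ≠ i is at most |H| − 1. -/
/-- A finite set mapped into itself by a permutation contains every point whose image lies
in it. -/
theorem Finset.mem_of_perm_apply_mem {V : Type*} {σ : Equiv.Perm V} {H : Finset V}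
    (hσ : ∀ i ∈ H, σ i ∈ H) {x : V} (hx : σ x ∈ H) : x ∈ H := by
  have hmap : H.map σ.toEmbedding = H := by
    refine Finset.eq_of_subset_of_card_le (fun y hy => ?_) (Finset.card_map _).ge
    obtain ⟨i, hi, rfl⟩ := Finset.mem_map.mp hy
    exact hσ i hi
  rw [← hmap] at hx
  obtain ⟨i, hi, hix⟩ := Finset.mem_map.mp hx
  exact σ.injective hix ▸ hi


/-- Validity of the Dantzig–Fulkerson–Johnson subtour elimination constraints:
if every non-fixed point of the successor permutation `σ` lies on the cycle of `σ`
through the depot, then for every nonempty set `H` of customers not containing the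
depot, the number of chosen edges with both endpoints in `H` is at most `|H| - 1`. -/
theorem stmt_4 {V : Type*} [Fintype V] [DecidableEq V]
    (depot : V) (σ : Equiv.Perm V)
    (hcyc : ∀ i, σ i ≠ i → ∃ r : ℕ, (⇑σ)^[r] depot = i) :
    ∀ H : Finset V, H.Nonempty → depot ∉ H →
      (H.filter (fun i => σ i ∈ H ∧ σ i ≠ i)).card ≤ H.card - 1 := by
  intro H hH hdepot
  refine Nat.le_sub_one_of_lt (Finset.card_lt_card (Finset.filter_ssubset.mpr ?_))
  by_contra! hall
  obtain ⟨h, hh⟩ := hH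
  obtain ⟨r, rfl⟩ := hcyc h (hall h hh).2
  have hiter : ∀ n : ℕ, (⇑σ)^[n] depot ∉ H := by
    intro n
    induction n with
    | zero => exact hdepot
    | succ n ih =>
      rw [Function.iterate_succ_apply']
      exact fun hn => ih (Finset.mem_of_perm_apply_mem (fun i hi => (hall i hi).1) hn)
  exact hiter r hh
end

section
/- Let V be a finite type with a distinguished depot vertex 0 and let σ : V → V be a bijection. The following are equivalent: (1) every non-fixed point of σ lies on the cycle of σ through the depot, i.e. for every i with σ i ≠ i there exists r ∈ ℕ with σ^[r] 0 = i; (2) for every nonempty subset H ⊆ V with 0 ∉ H, the number of vertices i ∈ H with σ i ∈ H and σ i ≠ i is at most |H| − 1. Moreover, if (1) fails, then a violated subset can be taken to be the σ-orbit of any non-fixed point whose orbit avoids 0: for such a set H one has σ i ∈ H and σ i ≠ i for every i ∈ H, so the count equals |H| > |H| − 1. -/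
/-- Reachability under iterates of a permutation of a finite type is symmetric. -/
theorem Equiv.Perm.exists_iterate_eq_symm {V : Type*} [Finite V] (σ : Equiv.Perm V) {a b : V}
    (h : ∃ r : ℕ, (⇑σ)^[r] a = b) : ∃ r : ℕ, (⇑σ)^[r] b = a := by
  obtain ⟨r, rfl⟩ := h
  have hs : σ.SameCycle ((⇑σ)^[r] a) a := by
    rw [← Equiv.Perm.coe_pow]
    exact (Equiv.Perm.SameCycle.refl σ a).pow_left
  obtain ⟨s, hs⟩ := hs.exists_nat_pow_eq
  exact ⟨s, by rwa [← Equiv.Perm.coe_pow]⟩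

/-- On the forward orbit of a non-fixed point, a permutation stays in the orbit and has no
fixed point. -/
theorem Equiv.Perm.apply_mem_and_ne_of_mem_forward_orbit {V : Type*} (σ : Equiv.Perm V) {a : V}
    (ha : σ a ≠ a) {H : Finset V} (hH : (↑H : Set V) = {j | ∃ r : ℕ, (⇑σ)^[r] a = j}) :
    ∀ i ∈ H, σ i ∈ H ∧ σ i ≠ i := by
  have mem (j : V) : j ∈ H ↔ ∃ r : ℕ, (⇑σ)^[r] a = j := by
    rw [← Finset.mem_coe, hH, Set.mem_ofPred_eq]
  intro i hi
  obtain ⟨r, rfl⟩ := (mem i).1 hi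
  rw [← Function.iterate_succ_apply' σ r a]
  refine ⟨(mem _).2 ⟨r + 1, rfl⟩, fun h => ha (σ.injective.iterate r ?_)⟩
  rwa [Function.iterate_succ_apply] at h

/-- The forward orbit of a non-fixed point, if it avoids the depot, violates its subtour
elimination constraint. -/
theorem Equiv.Perm.forward_orbit_violates {V : Type*} [DecidableEq V]
    (depot : V) (σ : Equiv.Perm V) (a : V) (ha : σ a ≠ a) (hd : ∀ r : ℕ, (⇑σ)^[r] a ≠ depot)
    (H : Finset V) (hH : (↑H : Set V) = {j | ∃ r : ℕ, (⇑σ)^[r] a = j}) :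
    H.Nonempty ∧ depot ∉ H ∧ (∀ i ∈ H, σ i ∈ H ∧ σ i ≠ i) ∧
      (H.filter (fun i => σ i ∈ H ∧ σ i ≠ i)).card = H.card ∧ H.card - 1 < H.card := by
  have mem (j : V) : j ∈ H ↔ ∃ r : ℕ, (⇑σ)^[r] a = j := by
    rw [← Finset.mem_coe, hH, Set.mem_ofPred_eq]
  have hne : H.Nonempty := ⟨a, (mem a).2 ⟨0, rfl⟩⟩
  have hall := σ.apply_mem_and_ne_of_mem_forward_orbit ha hH
  refine ⟨hne, fun h => ?_, hall, by rw [Finset.filter_true_of_mem hall],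
    Nat.sub_lt hne.card_pos one_pos⟩
  obtain ⟨r, hr⟩ := (mem depot).1 h
  exact hd r hr


/-- Correctness of the subtour-elimination separation procedure: all non-fixed points
of `σ` lie on the depot cycle iff all DFJ subtour elimination constraints hold; and if
not, the orbit of any non-fixed point avoiding the depot yields a violated subset. -/
theorem stmt_5 {V : Type*} [Fintype V] [DecidableEq V]
    (depot : V) (σ : Equiv.Perm V) :
    ((∀ i, σ i ≠ i → ∃ r : ℕ, (⇑σ)^[r] depot = i) ↔
      (∀ H : Finset V, H.Nonempty → depot ∉ H →
        (H.filter (fun i => σ i ∈ H ∧ σ i ≠ i)).card ≤ H.card - 1)) ∧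
    (∀ i₀, σ i₀ ≠ i₀ → (∀ r : ℕ, (⇑σ)^[r] i₀ ≠ depot) →
      ∀ H : Finset V, (↑H : Set V) = {j | ∃ r : ℕ, (⇑σ)^[r] i₀ = j} →
        H.Nonempty ∧ depot ∉ H ∧ (∀ i ∈ H, σ i ∈ H ∧ σ i ≠ i) ∧
          (H.filter (fun i => σ i ∈ H ∧ σ i ≠ i)).card = H.card ∧
          H.card - 1 < H.card) := by
  refine ⟨⟨fun h H hne hdep => ?_, fun h i hi => ?_⟩, σ.forward_orbit_violates depot⟩
  · apply Nat.le_sub_one_of_lt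
    refine (Finset.card_filter_le _ _).lt_of_ne fun heq => ?_
    have hall := Finset.card_filter_eq_iff.1 heq
    obtain ⟨i, hi⟩ := hne
    obtain ⟨r, hr⟩ := σ.exists_iterate_eq_symm (h i (hall i hi).2)
    have hmaps : Set.MapsTo σ (H : Set V) H := fun j hj => (hall j hj).1
    exact hdep (hr ▸ hmaps.iterate r hi)
  · by_contra hcon
    obtain ⟨hne, hdep, -, hcard, hlt⟩ := σ.forward_orbit_violates depot i hi
      (fun r hr => hcon (σ.exists_iterate_eq_symm ⟨r, hr⟩))
      (Set.toFinite {j | ∃ r : ℕ, (⇑σ)^[r] i = j}).toFinset (Set.Finite.coe_toFinset _)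
    exact absurd (h _ hne hdep) (by rw [hcard]; exact hlt.not_ge)
end
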